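/- For a spanning tree t of G_n and i ∈ {0,1,2}, let N_i(t) be the number of words w of length n over {1,2,3} such that the cell ψ_w(G_0) contains exactly i edges of t. Then the averages over uniformly random spanning trees satisfy lim_{n→∞} 3^{−n} (1/|T_n|) Σ_{t ∈ T_n} N_2(t) = 53/96, lim_{n→∞} 3^{−n} (1/|T_n|) Σ_{t ∈ T_n} N_1(t) = 19/48, and lim_{n→∞} 3^{−n} (1/|T_n|) Σ_{t ∈ T_n} N_0(t) = 5/96. -/

import Mathlib

attribute [local instance] Classical.propDecidable

noncomputable section

/-- Points in the plane. -/
abbrev Pt : Type := ℝ × ℝ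

/-- The three corner vertices `u₁ = (0,0)`, `u₂ = (1,0)`, `u₃ = (1/2, √3/2)`. -/
def cornerPt : Fin 3 → Pt
  | 0 => (0, 0)
  | 1 => (1, 0)
  | 2 => (1 / 2, Real.sqrt 3 / 2)

/-- The similitude `ψ_i(x) = (x + u_i)/2`. -/
def psi (i : Fin 3) (x : Pt) : Pt := ((x.1 + (cornerPt i).1) / 2, (x.2 + (cornerPt i).2) / 2)

/-- Vertex set of the Sierpiński graph `G_n`. -/
def sierpV : ℕ → Finset Pt
  | 0 => {cornerPt 0, cornerPt 1, cornerPt 2}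
  | n + 1 => (sierpV n).image (psi 0) ∪ (sierpV n).image (psi 1) ∪ (sierpV n).image (psi 2)

/-- Edge set of the Sierpiński graph `G_n`. -/
def sierpE : ℕ → Finset (Sym2 Pt)
  | 0 => {s(cornerPt 0, cornerPt 1), s(cornerPt 1, cornerPt 2), s(cornerPt 2, cornerPt 0)}
  | n + 1 =>
      (sierpE n).image (Sym2.map (psi 0)) ∪ (sierpE n).image (Sym2.map (psi 1)) ∪
        (sierpE n).image (Sym2.map (psi 2))

/-- The simple graph spanned by a finite set of edges. -/
def graphOf (F : Finset (Sym2 Pt)) : SimpleGraph Pt := SimpleGraph.fromEdgeSet ↑F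

/-- Spanning trees of `G_n`: acyclic edge subsets connecting all vertices of `G_n`. -/
def treeSet (n : ℕ) : Finset (Finset (Sym2 Pt)) :=
  (sierpE n).powerset.filter fun F =>
    (graphOf F).IsAcyclic ∧ ∀ x ∈ sierpV n, ∀ y ∈ sierpV n, (graphOf F).Reachable x y

/-- `S_n^i` (with `i : Fin 3` zero-based): spanning forests of `G_n` with exactly two
components, one containing corner `i`, the other containing the two remaining corners. -/
def twoForestSet (n : ℕ) (i : Fin 3) : Finset (Finset (Sym2 Pt)) :=
  (sierpE n).powerset.filter fun F =>
    (graphOf F).IsAcyclic ∧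
    (∀ j, j ≠ i → ¬ (graphOf F).Reachable (cornerPt i) (cornerPt j)) ∧
    (∀ j k, j ≠ i → k ≠ i → (graphOf F).Reachable (cornerPt j) (cornerPt k)) ∧
    (∀ x ∈ sierpV n, ∃ j, (graphOf F).Reachable (cornerPt j) x)

/-- `R_n`: spanning forests of `G_n` with exactly three components, each containing
exactly one corner vertex. -/
def threeForestSet (n : ℕ) : Finset (Finset (Sym2 Pt)) :=
  (sierpE n).powerset.filter fun F =>
    (graphOf F).IsAcyclic ∧
    (∀ j k, j ≠ k → ¬ (graphOf F).Reachable (cornerPt j) (cornerPt k)) ∧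
    (∀ x ∈ sierpV n, ∃ j, (graphOf F).Reachable (cornerPt j) x)

/-- Edges of the copy `ψ_i(G_n)` inside `G_{n+1}`. -/
def psiCellE (i : Fin 3) (n : ℕ) : Finset (Sym2 Pt) := (sierpE n).image (Sym2.map (psi i))

/-- The class `T_n^i`: for `n ≥ 1`, spanning trees whose unique path from corner `i`
to any other corner `j` stays in `ψ_i(G_{n-1}) ∪ ψ_j(G_{n-1})`; for `n = 0` the
singleton consisting of the two edges of `G_0` incident with corner `i`. -/
def treeClass : ℕ → Fin 3 → Finset (Finset (Sym2 Pt))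
  | 0, i => {(sierpE 0).filter fun e => cornerPt i ∈ e}
  | n + 1, i =>
      (treeSet (n + 1)).filter fun F =>
        ∀ j, j ≠ i → ∀ p : (graphOf F).Walk (cornerPt i) (cornerPt j), p.IsPath →
          ∀ e ∈ p.edges, e ∈ psiCellE i n ∪ psiCellE j n

/-- `ψ_w = ψ_{w₁} ∘ ⋯ ∘ ψ_{w_k}` for a word `w` of length `k`. -/
def psiWord {k : ℕ} (w : Fin k → Fin 3) : Pt → Pt :=
  (List.ofFn w).foldr (fun i g => psi i ∘ g) id

/-- The restriction `π_w(F) = ψ_w^{-1}(F ∩ ψ_w(G_{m-k}))` of an edge set `F ⊆ E G_m`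
to the `k`-part indexed by the word `w`, as a subgraph of `G_{m-k}`. -/
def restrictE {k : ℕ} (w : Fin k → Fin 3) (m : ℕ) (F : Finset (Sym2 Pt)) :
    Finset (Sym2 Pt) :=
  (sierpE (m - k)).filter fun e => Sym2.map (psiWord w) e ∈ F

/-- Number of connected components of the subgraph with edge set `F`,
on the vertex set of `G_m`. -/
def ncomp (m : ℕ) (F : Finset (Sym2 Pt)) : ℕ :=
  Set.ncard {C : Set Pt | ∃ v ∈ sierpV m, C = {x : Pt | x ∈ sierpV m ∧ (graphOf F).Reachable v x}}

/-- Degree of `v` in the edge set `F`. -/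
def degIn (F : Finset (Sym2 Pt)) (v : Pt) : ℕ := (F.filter fun e => v ∈ e).card

/-- The subgraph of `G_0` replacing a forest in `Q_1`, used in the trace construction. -/
def traceCell (g : Finset (Sym2 Pt)) : Finset (Sym2 Pt) :=
  if g ∈ treeClass 1 0 then (sierpE 0).filter (fun e => cornerPt 0 ∈ e)
  else if g ∈ treeClass 1 1 then (sierpE 0).filter (fun e => cornerPt 1 ∈ e)
  else if g ∈ treeClass 1 2 then (sierpE 0).filter (fun e => cornerPt 2 ∈ e)
  else if g ∈ twoForestSet 1 0 then (sierpE 0).filter (fun e => cornerPt 0 ∉ e)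
  else if g ∈ twoForestSet 1 1 then (sierpE 0).filter (fun e => cornerPt 1 ∉ e)
  else if g ∈ twoForestSet 1 2 then (sierpE 0).filter (fun e => cornerPt 2 ∉ e)
  else ∅

/-- The trace `Tr f ⊆ E G_n` of an edge set `f ⊆ E G_{n+1}`. -/
def trace (n : ℕ) (f : Finset (Sym2 Pt)) : Finset (Sym2 Pt) :=
  Finset.univ.biUnion fun w : Fin n → Fin 3 =>
    (traceCell (restrictE w (n + 1) f)).image (Sym2.map (psiWord w))

/-- `Q_n = T_n ∪ S_n^1 ∪ S_n^2 ∪ S_n^3 ∪ R_n`. -/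
def qSet (n : ℕ) : Finset (Finset (Sym2 Pt)) :=
  treeSet n ∪ twoForestSet n 0 ∪ twoForestSet n 1 ∪ twoForestSet n 2 ∪ threeForestSet n

open Filter

/-- The number of `n`-cells `ψ_w(G_0)` of `G_n` containing exactly `i` edges of `t`. -/
def cellTypeCount (n : ℕ) (i : ℕ) (t : Finset (Sym2 Pt)) : ℕ :=
  (Finset.univ.filter fun w : Fin n → Fin 3 =>
    (t.filter fun e => e ∈ (sierpE 0).image (Sym2.map (psiWord w))).card = i).card

theorem reachable_invariant {α : Type*} {G : SimpleGraph α} {P : α → Prop}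
    (h : ∀ x y, P x → G.Adj x y → P y) {x y : α} (hxy : G.Reachable x y) (hx : P x) : P y := by
  obtain ⟨p⟩ := hxy
  induction p with
  | nil => exact hx
  | cons hadj _ ih => exact ih (h _ _ hx hadj)

theorem graphOf_adj {F : Finset (Sym2 Pt)} {x y : Pt} :
    (graphOf F).Adj x y ↔ s(x, y) ∈ F ∧ x ≠ y := by
  simp [graphOf]

theorem graphOf_mono {F F' : Finset (Sym2 Pt)} (h : F ⊆ F') : graphOf F ≤ graphOf F' :=
  SimpleGraph.fromEdgeSet_mono (by exact_mod_cast h)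

theorem reachable_insert {F : Finset (Sym2 Pt)} {a b x y : Pt}
    (h : (graphOf (insert s(a, b) F)).Reachable x y) :
    (graphOf F).Reachable x y ∨ ((graphOf F).Reachable x a ∧ (graphOf F).Reachable b y) ∨
      ((graphOf F).Reachable x b ∧ (graphOf F).Reachable a y) := by
  refine reachable_invariant (P := fun y => (graphOf F).Reachable x y ∨
    ((graphOf F).Reachable x a ∧ (graphOf F).Reachable b y) ∨
      ((graphOf F).Reachable x b ∧ (graphOf F).Reachable a y)) ?_ h (Or.inl .rfl)
  intro u v hu huv
  obtain ⟨hmem, hne⟩ := graphOf_adj.1 huv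
  rcases Finset.mem_insert.1 hmem with he | hmem
  · rcases Sym2.eq_iff.1 he with ⟨rfl, rfl⟩ | ⟨rfl, rfl⟩
    · rcases hu with hu | ⟨hu, -⟩ | ⟨hu, -⟩
      · exact Or.inr (Or.inl ⟨hu, .rfl⟩)
      · exact Or.inr (Or.inl ⟨hu, .rfl⟩)
      · exact Or.inl hu
    · rcases hu with hu | ⟨hu, -⟩ | ⟨hu, -⟩
      · exact Or.inr (Or.inr ⟨hu, .rfl⟩)
      · exact Or.inl hu
      · exact Or.inr (Or.inr ⟨hu, .rfl⟩)
  · have hr : (graphOf F).Reachable u v := (graphOf_adj.2 ⟨hmem, hne⟩).reachable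
    rcases hu with hu | ⟨hu, hu'⟩ | ⟨hu, hu'⟩
    · exact Or.inl (hu.trans hr)
    · exact Or.inr (Or.inl ⟨hu, hu'.trans hr⟩)
    · exact Or.inr (Or.inr ⟨hu, hu'.trans hr⟩)

/-- The connected components of the graph with edge set `F` that meet `V`. -/
def comps (V : Finset Pt) (F : Finset (Sym2 Pt)) : Finset (graphOf F).ConnectedComponent :=
  V.image (graphOf F).connectedComponentMk

theorem card_comps_congr (V : Finset Pt) {F F' : Finset (Sym2 Pt)}
    (h : ∀ x y, (graphOf F).Reachable x y ↔ (graphOf F').Reachable x y) :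
    (comps V F).card = (comps V F').card := by
  have h0 : (graphOf F).connectedComponentMk = fun x => (graphOf F).connectedComponentMk x := rfl
  refine Finset.card_bij'
    (fun c _ => c.lift (fun x => (graphOf F').connectedComponentMk x)
      (fun u v p _ => SimpleGraph.ConnectedComponent.sound ((h u v).1 ⟨p⟩)))
    (fun c _ => c.lift (fun x => (graphOf F).connectedComponentMk x)
      (fun u v p _ => SimpleGraph.ConnectedComponent.sound ((h u v).2 ⟨p⟩))) ?_ ?_ ?_ ?_
  · intro c hc
    obtain ⟨x, hx, rfl⟩ := Finset.mem_image.1 hc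
    exact Finset.mem_image_of_mem _ hx
  · intro c hc
    obtain ⟨x, hx, rfl⟩ := Finset.mem_image.1 hc
    exact Finset.mem_image_of_mem _ hx
  · intro c hc
    obtain ⟨x, hx, rfl⟩ := Finset.mem_image.1 hc
    rfl
  · intro c hc
    obtain ⟨x, hx, rfl⟩ := Finset.mem_image.1 hc
    rfl

theorem card_comps_insert {V : Finset Pt} {F : Finset (Sym2 Pt)} {a b : Pt}
    (ha : a ∈ V) (hb : b ∈ V) (hab : ¬ (graphOf F).Reachable a b) :
    (comps V (insert s(a, b) F)).card + 1 = (comps V F).card := by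
  have hle : graphOf F ≤ graphOf (insert s(a, b) F) := graphOf_mono (Finset.subset_insert _ _)
  have hab' : (graphOf (insert s(a, b) F)).Reachable a b :=
    (graphOf_adj.2 ⟨Finset.mem_insert_self _ _, by rintro rfl; exact hab .rfl⟩).reachable
  have hbm : (graphOf F).connectedComponentMk b ∈ comps V F := Finset.mem_image_of_mem _ hb
  rw [← Finset.card_erase_add_one hbm]
  congr 1
  symm
  refine Finset.card_bij (fun c _ => c.map (SimpleGraph.Hom.ofLE hle)) ?_ ?_ ?_
  · intro c hc
    obtain ⟨x, hx, rfl⟩ := Finset.mem_image.1 (Finset.mem_of_mem_erase hc)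
    exact Finset.mem_image_of_mem _ hx
  · intro c hc d hd hcd
    obtain ⟨x, hx, rfl⟩ := Finset.mem_image.1 (Finset.mem_of_mem_erase hc)
    obtain ⟨y, hy, rfl⟩ := Finset.mem_image.1 (Finset.mem_of_mem_erase hd)
    have hxb := Finset.ne_of_mem_erase hc
    have hyb := Finset.ne_of_mem_erase hd
    rcases reachable_insert (SimpleGraph.ConnectedComponent.exact hcd) with h | ⟨-, h⟩ | ⟨h, -⟩
    · exact SimpleGraph.ConnectedComponent.sound h
    · exact absurd (SimpleGraph.ConnectedComponent.sound h.symm) hyb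
    · exact absurd (SimpleGraph.ConnectedComponent.sound h) hxb
  · intro c hc
    obtain ⟨x, hx, rfl⟩ := Finset.mem_image.1 hc
    by_cases hxb : (graphOf F).connectedComponentMk x = (graphOf F).connectedComponentMk b
    · refine ⟨(graphOf F).connectedComponentMk a, Finset.mem_erase.2
        ⟨fun h => hab (SimpleGraph.ConnectedComponent.exact h), Finset.mem_image_of_mem _ ha⟩, ?_⟩
      exact SimpleGraph.ConnectedComponent.sound
        (hab'.trans ((SimpleGraph.ConnectedComponent.exact hxb).mono hle).symm)
    · exact ⟨_, Finset.mem_erase.2 ⟨hxb, Finset.mem_image_of_mem _ hx⟩, rfl⟩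

theorem card_le_and_isAcyclic_iff (V : Finset Pt) (F : Finset (Sym2 Pt))
    (hV : ∀ e ∈ F, ∀ x ∈ e, x ∈ V) (hd : ∀ e ∈ F, ¬ e.IsDiag) :
    V.card ≤ F.card + (comps V F).card ∧
      ((graphOf F).IsAcyclic ↔ F.card + (comps V F).card = V.card) := by
  induction F using Finset.induction_on with
  | empty =>
    have hbot : graphOf ∅ = ⊥ := by simp [graphOf]
    have hc : (comps V ∅).card = V.card := by
      refine Finset.card_image_of_injective _ fun x y h => ?_
      have := SimpleGraph.ConnectedComponent.exact h
      rw [hbot] at this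
      simpa using this
    refine ⟨by simp [hc], by simp [hc, hbot]⟩
  | insert e F he ih =>
    obtain ⟨ih1, ih2⟩ := ih (fun e h => hV e (Finset.mem_insert_of_mem h))
      (fun e h => hd e (Finset.mem_insert_of_mem h))
    have hV' := hV e (Finset.mem_insert_self _ _)
    have hd' := hd e (Finset.mem_insert_self _ _)
    clear hV hd
    induction e with | _ a b
    have ha := hV' a (by simp)
    have hb := hV' b (by simp)
    have hne : a ≠ b := by simpa using hd'
    have hsup : graphOf (insert s(a, b) F) = graphOf F ⊔ SimpleGraph.fromEdgeSet {s(a, b)} := by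
      ext x y
      simp only [graphOf_adj, SimpleGraph.sup_adj, SimpleGraph.fromEdgeSet_adj,
        Finset.mem_insert, Set.mem_singleton_iff]
      tauto
    rw [Finset.card_insert_of_notMem he]
    by_cases hab : (graphOf F).Reachable a b
    · have hle : graphOf F ≤ graphOf (insert s(a, b) F) := graphOf_mono (Finset.subset_insert _ _)
      have hc : (comps V (insert s(a, b) F)).card = (comps V F).card := by
        refine card_comps_congr V fun x y => ⟨fun h => ?_, fun h => h.mono hle⟩
        rcases reachable_insert h with h | ⟨h, h'⟩ | ⟨h, h'⟩
        · exact h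
        · exact h.trans (hab.trans h')
        · exact h.trans (hab.symm.trans h')
      rw [hc]
      refine ⟨by omega, ⟨fun hac => ?_, fun h => by omega⟩⟩
      have hbr := SimpleGraph.isAcyclic_iff_forall_adj_isBridge.1 hac
        (graphOf_adj.2 ⟨Finset.mem_insert_self _ _, hne⟩)
      rw [SimpleGraph.isBridge_iff] at hbr
      refine absurd (hab.mono ?_) hbr
      intro x y hxy
      obtain ⟨h1, h2⟩ := graphOf_adj.1 hxy
      rw [SimpleGraph.deleteEdges_adj]
      refine ⟨hle hxy, fun h => he ?_⟩
      rw [Set.mem_singleton_iff] at h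
      exact h ▸ h1
    · have hc := card_comps_insert ha hb hab
      have hac : (graphOf (insert s(a, b) F)).IsAcyclic ↔ (graphOf F).IsAcyclic := by
        rw [hsup]
        exact SimpleGraph.isAcyclic_add_edge_iff_of_not_reachable _ _ hab
      refine ⟨by omega, ?_⟩
      rw [hac, ih2]
      omega

section FinitePatterns

attribute [local instance] instDecidableEqNat instDecidableEqFin instDecidableAnd instDecidableOr
  instDecidableIff Multiset.decidableEq Multiset.decidableMem Finset.decidableMem
  Fintype.decidableForallFintype Fintype.decidableExistsFintype

/-- The five partitions of the three corners, given by labels: `0` is the partition with one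
block, `1`, `2`, `3` separate the corner `0`, `1`, `2` from the others, and `4` has three blocks. -/
def lab (k : Fin 5) (i : Fin 3) : ℕ :=
  match k with
  | 0 => 0
  | 1 => bif Nat.beq i.val 0 then 0 else 1
  | 2 => bif Nat.beq i.val 1 then 1 else 0
  | 3 => bif Nat.beq i.val 2 then 2 else 0
  | 4 => i.val

/-- The number of blocks of a partition of the corners. -/
def blocks (k : Fin 5) : ℕ :=
  match k with
  | 0 => 1
  | 4 => 3
  | _ => 2

/-- The labelling obtained from `l` by giving the class of `a` the label of `b`. -/
def merge {α : Type*} (l : α → ℕ) (a b x : α) : ℕ :=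
  bif Nat.beq (l x) (l a) then l b else l x

/-- Labels on the pairs `(i, a)`, standing for the corner `a` of the `i`-th copy: two pairs have
the same label when they are connected by the partitions `k i` after the copies are glued. -/
def glueLabel (k : Fin 3 → Fin 5) : Fin 3 × Fin 3 → ℕ :=
  merge (merge (merge (fun p => 3 * p.1.val + lab (k p.1) p.2) (0, 1) (1, 0)) (0, 2) (2, 0))
    (1, 2) (2, 1)

/-- The partitions `k i` of the corners of the three copies for which spanning forests of the
copies glue to a spanning forest whose partition of the outer corners is `κ`. -/
def goodTriples (κ : Fin 5) : Finset (Fin 3 → Fin 5) :=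
  Finset.univ.filter fun k =>
    blocks (k 0) + blocks (k 1) + blocks (k 2) = 3 + blocks κ ∧
    (∀ i j, glueLabel k (i, i) = glueLabel k (j, j) ↔ lab κ i = lab κ j) ∧
    ∀ i a, ∃ j, glueLabel k (i, a) = glueLabel k (j, j)

theorem mem_goodTriples {κ : Fin 5} {k : Fin 3 → Fin 5} :
    k ∈ goodTriples κ ↔ blocks (k 0) + blocks (k 1) + blocks (k 2) = 3 + blocks κ ∧
      (∀ i j, glueLabel k (i, i) = glueLabel k (j, j) ↔ lab κ i = lab κ j) ∧
      ∀ i a, ∃ j, glueLabel k (i, a) = glueLabel k (j, j) := by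
  simp [goodTriples]

/-- The numbers of partitions among the `k i` with one block and with three blocks. -/
def pattern (k : Fin 3 → Fin 5) : ℕ × ℕ :=
  ((Finset.univ.filter fun i => k i = 0).card, (Finset.univ.filter fun i => k i = 4).card)

theorem map_pattern_goodTriples (κ : Fin 5) :
    (goodTriples κ).val.map pattern =
      match κ with
      | 0 => Multiset.replicate 6 (2, 0)
      | 4 => Multiset.replicate 14 (0, 0) + Multiset.replicate 12 (1, 1)
      | _ => Multiset.replicate 7 (1, 0) + Multiset.replicate 1 (2, 1) := by
  revert κ
  decide +kernel

theorem lab_injective {κ κ' : Fin 5} (h : ∀ i j, lab κ i = lab κ j ↔ lab κ' i = lab κ' j) :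
    κ = κ' := by
  revert κ κ'
  decide +kernel

theorem card_image_lab (κ : Fin 5) : (Finset.univ.image (lab κ)).card = blocks κ := by
  revert κ
  decide +kernel

theorem merge_of_eq {α : Type*} {l : α → ℕ} (a b : α) {x y : α} (h : l x = l y) :
    merge l a b x = merge l a b y := by
  simp only [merge, h]

theorem merge_self {α : Type*} (l : α → ℕ) (a b : α) : merge l a b a = merge l a b b := by
  by_cases h : l b = l a <;> simp [merge, h]

theorem rel_of_merge_eq {α β : Type*} {G : SimpleGraph β} {l : α → ℕ} {f : α → β}
    (h : ∀ x y, l x = l y → G.Reachable (f x) (f y)) {a b : α} (hab : G.Reachable (f a) (f b))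
    (x y : α) (hxy : merge l a b x = merge l a b y) : G.Reachable (f x) (f y) := by
  unfold merge at hxy
  by_cases hx : l x = l a <;> by_cases hy : l y = l a
  · exact h _ _ (hx.trans hy.symm)
  · have hy' : Nat.beq (l y) (l a) = false := by simpa [← Bool.not_eq_true] using hy
    rw [hx, Nat.beq_refl, hy'] at hxy
    exact (h _ _ hx).trans (hab.trans (h _ _ hxy))
  · have hx' : Nat.beq (l x) (l a) = false := by simpa [← Bool.not_eq_true] using hx
    rw [hy, Nat.beq_refl, hx'] at hxy
    exact (h _ _ hxy).trans (hab.symm.trans (h _ _ hy.symm))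
  · have hx' : Nat.beq (l x) (l a) = false := by simpa [← Bool.not_eq_true] using hx
    have hy' : Nat.beq (l y) (l a) = false := by simpa [← Bool.not_eq_true] using hy
    rw [hx', hy'] at hxy
    exact h _ _ hxy

theorem lab_lt (κ : Fin 5) (i : Fin 3) : lab κ i < 3 := by
  revert κ i
  decide +kernel

theorem glueLabel_of_lab_eq {k : Fin 3 → Fin 5} {i a b : Fin 3} (h : lab (k i) a = lab (k i) b) :
    glueLabel k (i, a) = glueLabel k (i, b) :=
  merge_of_eq _ _ (merge_of_eq _ _ (merge_of_eq _ _ (by simp only [h])))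

theorem glueLabel_swap (k : Fin 3 → Fin 5) (i j : Fin 3) :
    glueLabel k (i, j) = glueLabel k (j, i) := by
  have h01 : glueLabel k (0, 1) = glueLabel k (1, 0) :=
    merge_of_eq _ _ (merge_of_eq _ _ (merge_self _ _ _))
  have h02 : glueLabel k (0, 2) = glueLabel k (2, 0) := merge_of_eq _ _ (merge_self _ _ _)
  have h12 : glueLabel k (1, 2) = glueLabel k (2, 1) := merge_self _ _ _
  fin_cases i <;> fin_cases j <;> first | rfl | assumption | (symm; assumption)

theorem reachable_of_glueLabel_eq {β : Type*} {G : SimpleGraph β} {k : Fin 3 → Fin 5}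
    {f : Fin 3 × Fin 3 → β}
    (h : ∀ i a b, lab (k i) a = lab (k i) b → G.Reachable (f (i, a)) (f (i, b)))
    (hs : ∀ i j, G.Reachable (f (i, j)) (f (j, i))) {p q : Fin 3 × Fin 3}
    (hpq : glueLabel k p = glueLabel k q) : G.Reachable (f p) (f q) := by
  refine rel_of_merge_eq (rel_of_merge_eq (rel_of_merge_eq ?_ (hs _ _)) (hs _ _)) (hs _ _) p q hpq
  rintro ⟨i, a⟩ ⟨j, b⟩ hab
  have h1 := lab_lt (k i) a
  have h2 := lab_lt (k j) b
  simp only at hab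
  obtain rfl : i = j := by apply Fin.ext; omega
  exact h i a b (by omega)

theorem exists_lab {r : Fin 3 → Fin 3 → Prop} (hr : Equivalence r) :
    ∃ κ, ∀ i j, r i j ↔ lab κ i = lab κ j := by
  have hs : ∀ {i j}, r i j → r j i := hr.symm
  have ht : ∀ {i j k}, r i j → r j k → r i k := hr.trans
  have hsi : ∀ i j, r i j ↔ r j i := fun i j => ⟨hs, hs⟩
  by_cases h01 : r 0 1
  · by_cases h02 : r 0 2
    · have h12 := ht (hs h01) h02
      exact ⟨0, by simp [Fin.forall_fin_succ, lab, hr.refl, *, hsi 1 0, hsi 2 0, hsi 2 1]⟩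
    · have h12 : ¬ r 1 2 := fun h => h02 (ht h01 h)
      exact ⟨3, by simp [Fin.forall_fin_succ, lab, hr.refl, *, hsi 1 0, hsi 2 0, hsi 2 1]; decide⟩
  · by_cases h02 : r 0 2
    · have h12 : ¬ r 1 2 := fun h => h01 (ht h02 (hs h))
      exact ⟨2, by simp [Fin.forall_fin_succ, lab, hr.refl, *, hsi 1 0, hsi 2 0, hsi 2 1]; decide⟩
    · by_cases h12 : r 1 2
      · exact ⟨1, by simp [Fin.forall_fin_succ, lab, hr.refl, *, hsi 1 0, hsi 2 0, hsi 2 1]; decide⟩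
      · exact ⟨4, by simp [Fin.forall_fin_succ, lab, hr.refl, *, hsi 1 0, hsi 2 0, hsi 2 1]⟩

theorem prod_eq_of_pattern {R : Type*} [CommRing R] (t s r : R) (k : Fin 3 → Fin 5) :
    ∏ i, (if k i = 0 then t else if k i = 4 then r else s) =
      t ^ (pattern k).1 * r ^ (pattern k).2 * s ^ (3 - (pattern k).1 - (pattern k).2) := by
  have h : ∀ i, k i = 0 ∨ k i = 4 ∨ (k i ≠ 0 ∧ k i ≠ 4) := by
    intro i
    tauto
  simp only [pattern, Finset.card_filter, Fin.sum_univ_three, Fin.prod_univ_three]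
  rcases h 0 with h0 | h0 | h0 <;> rcases h 1 with h1 | h1 | h1 <;>
    rcases h 2 with h2 | h2 | h2 <;> simp [h0, h1, h2] <;> ring

/-- Whether the corners `i` and `j` are connected by the edges opposite to the corners in `A`. -/
def triangleConn (A : Finset (Fin 3)) (i j : Fin 3) : Prop :=
  i = j ∨ -(i + j) ∈ A ∨ (i ∈ A ∧ j ∈ A)

theorem triangleConn_step {A : Finset (Fin 3)} {i k : Fin 3} (hk : k ∈ A) :
    triangleConn A i (k + 1) ↔ triangleConn A i (k + 2) := by
  revert A i k
  unfold triangleConn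
  decide +kernel

theorem opposite_edge {i j : Fin 3} (h : i ≠ j) :
    (-(i + j) + 1 = i ∧ -(i + j) + 2 = j) ∨ (-(i + j) + 1 = j ∧ -(i + j) + 2 = i) := by
  revert i j
  decide +kernel

/-- The sets of edges of a triangle, given by the opposite corners, forming a spanning forest
with partition `κ`. -/
def triangleForests (κ : Fin 5) : Finset (Finset (Fin 3)) :=
  Finset.univ.filter fun A => A.card + blocks κ = 3 ∧
    ∀ i j, (i = j ∨ -(i + j) ∈ A ∨ (i ∈ A ∧ j ∈ A)) ↔ lab κ i = lab κ j

theorem mem_triangleForests {κ : Fin 5} {A : Finset (Fin 3)} :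
    A ∈ triangleForests κ ↔ A.card + blocks κ = 3 ∧
      ∀ i j, triangleConn A i j ↔ lab κ i = lab κ j := by
  simp [triangleForests, triangleConn]

theorem card_triangleForests (κ : Fin 5) :
    (triangleForests κ).card = if κ = 0 then 3 else 1 := by
  revert κ
  decide +kernel

end FinitePatterns

/-- The barycentric coordinates of a point with respect to the three corners. -/
def bary (k : Fin 3) (x : Pt) : ℝ :=
  match k with
  | 0 => 1 - x.1 - x.2 / √3
  | 1 => x.1 - x.2 / √3
  | 2 => 2 * x.2 / √3

theorem bary_sum (x : Pt) : bary 0 x + bary 1 x + bary 2 x = 1 := by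
  simp only [bary]
  ring

theorem bary_cornerPt (k j : Fin 3) : bary k (cornerPt j) = if k = j then 1 else 0 := by
  have h : √3 ≠ 0 := by positivity
  fin_cases k <;> fin_cases j <;> simp [bary, cornerPt] <;> field_simp <;> norm_num

theorem bary_psi (k i : Fin 3) (x : Pt) :
    bary k (psi i x) = (bary k x + if k = i then 1 else 0) / 2 := by
  rw [← bary_cornerPt k i]
  fin_cases k <;> simp only [bary, psi] <;> ring

theorem bary_ext {x y : Pt} (h : ∀ k, bary k x = bary k y) : x = y := by
  have h3 : √3 ≠ 0 := by positivity
  have h1 := h 1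
  have h2 := h 2
  simp only [bary] at h1 h2
  have hy : x.2 = y.2 := by
    field_simp at h2
    linarith
  rw [hy] at h1
  exact Prod.ext (by linarith) hy

theorem cornerPt_injective : Function.Injective cornerPt := by
  intro i j h
  by_contra hij
  have := bary_cornerPt i j
  rw [← h, bary_cornerPt] at this
  simp [hij] at this

theorem psi_injective (i : Fin 3) : Function.Injective (psi i) := by
  intro x y h
  simp only [psi, Prod.mk.injEq] at h
  exact Prod.ext (by linarith [h.1]) (by linarith [h.2])

theorem psi_cornerPt_self (i : Fin 3) : psi i (cornerPt i) = cornerPt i := by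
  simp [psi]

theorem psi_cornerPt_comm (i j : Fin 3) : psi i (cornerPt j) = psi j (cornerPt i) := by
  simp [psi, add_comm]

theorem mem_sierpV_zero {x : Pt} : x ∈ sierpV 0 ↔ ∃ i, x = cornerPt i := by
  simp [sierpV, Fin.exists_fin_succ]

theorem mem_sierpV_succ {n : ℕ} {x : Pt} :
    x ∈ sierpV (n + 1) ↔ ∃ i, ∃ v ∈ sierpV n, psi i v = x := by
  simp [sierpV, Fin.exists_fin_succ]

theorem mem_sierpE_succ {n : ℕ} {e : Sym2 Pt} :
    e ∈ sierpE (n + 1) ↔ ∃ i, ∃ e' ∈ sierpE n, e'.map (psi i) = e := by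
  simp [sierpE, Fin.exists_fin_succ]

theorem cornerPt_mem_sierpV (n : ℕ) (i : Fin 3) : cornerPt i ∈ sierpV n := by
  induction n with
  | zero => exact mem_sierpV_zero.2 ⟨i, rfl⟩
  | succ n ih => exact mem_sierpV_succ.2 ⟨i, _, ih, psi_cornerPt_self i⟩

theorem bary_nonneg {n : ℕ} {x : Pt} (hx : x ∈ sierpV n) (k : Fin 3) : 0 ≤ bary k x := by
  induction n generalizing x with
  | zero =>
    obtain ⟨i, rfl⟩ := mem_sierpV_zero.1 hx
    rw [bary_cornerPt]
    split_ifs <;> norm_num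
  | succ n ih =>
    obtain ⟨i, v, hv, rfl⟩ := mem_sierpV_succ.1 hx
    have := ih hv
    rw [bary_psi]
    split_ifs <;> linarith

theorem eq_cornerPt_of_one_le_bary {n : ℕ} {x : Pt} (hx : x ∈ sierpV n) {i : Fin 3}
    (h : 1 ≤ bary i x) : x = cornerPt i := by
  have hs := bary_sum x
  have h0 := bary_nonneg hx 0
  have h1 := bary_nonneg hx 1
  have h2 := bary_nonneg hx 2
  apply bary_ext
  intro k
  rw [bary_cornerPt]
  fin_cases i <;> fin_cases k <;> simp at h ⊢ <;> linarith

theorem eq_cornerPt_of_psi_eq {n : ℕ} {v w : Pt} (hv : v ∈ sierpV n) (hw : w ∈ sierpV n)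
    {i j : Fin 3} (hij : i ≠ j) (h : psi i v = psi j w) : v = cornerPt j ∧ w = cornerPt i := by
  have hi := congrArg (bary i) h
  have hj := congrArg (bary j) h
  rw [bary_psi, bary_psi, if_pos rfl, if_neg hij] at hi
  rw [bary_psi, bary_psi, if_pos rfl, if_neg hij.symm] at hj
  have := bary_nonneg hv i
  have := bary_nonneg hw j
  exact ⟨eq_cornerPt_of_one_le_bary hv (by linarith), eq_cornerPt_of_one_le_bary hw (by linarith)⟩

theorem eq_cornerPt_of_psi_eq_cornerPt {n : ℕ} {v : Pt} (hv : v ∈ sierpV n) {i j : Fin 3}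
    (h : psi i v = cornerPt j) : v = cornerPt j := by
  by_cases hij : i = j
  · subst hij
    exact psi_injective i (h.trans (psi_cornerPt_self i).symm)
  · exact (eq_cornerPt_of_psi_eq hv (cornerPt_mem_sierpV n j) hij
      (h.trans (psi_cornerPt_self j).symm)).1

theorem mem_sierpV_of_mem_sierpE {n : ℕ} {e : Sym2 Pt} (he : e ∈ sierpE n) {x : Pt}
    (hx : x ∈ e) : x ∈ sierpV n := by
  induction n generalizing e x with
  | zero =>
    simp only [sierpE, Finset.mem_insert, Finset.mem_singleton] at he
    rcases he with rfl | rfl | rfl <;>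
    · rcases Sym2.mem_iff.1 hx with rfl | rfl <;> exact cornerPt_mem_sierpV 0 _
  | succ n ih =>
    obtain ⟨i, e', he', rfl⟩ := mem_sierpE_succ.1 he
    obtain ⟨y, hy, rfl⟩ := Sym2.mem_map.1 hx
    exact mem_sierpV_succ.2 ⟨i, y, ih he' hy, rfl⟩

theorem not_isDiag_of_mem_sierpE {n : ℕ} {e : Sym2 Pt} (he : e ∈ sierpE n) : ¬ e.IsDiag := by
  induction n generalizing e with
  | zero =>
    simp only [sierpE, Finset.mem_insert, Finset.mem_singleton] at he
    rcases he with rfl | rfl | rfl <;> simp [cornerPt_injective.eq_iff]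
  | succ n ih =>
    obtain ⟨i, e', he', rfl⟩ := mem_sierpE_succ.1 he
    have := ih he'
    rwa [Sym2.isDiag_map (psi_injective i)]

theorem eq_of_map_psi_eq {n : ℕ} {e e' : Sym2 Pt} (he : e ∈ sierpE n) (he' : e' ∈ sierpE n)
    {i j : Fin 3} (h : e.map (psi i) = e'.map (psi j)) : i = j ∧ e = e' := by
  by_cases hij : i = j
  · subst hij
    exact ⟨rfl, Sym2.map.injective (psi_injective i) h⟩
  · exfalso
    apply not_isDiag_of_mem_sierpE he
    have key : ∀ x ∈ e, x = cornerPt j := by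
      intro x hx
      have hx' : psi i x ∈ e'.map (psi j) := h ▸ Sym2.mem_map.2 ⟨x, hx, rfl⟩
      obtain ⟨y, hy, hxy⟩ := Sym2.mem_map.1 hx'
      exact (eq_cornerPt_of_psi_eq (mem_sierpV_of_mem_sierpE he hx)
        (mem_sierpV_of_mem_sierpE he' hy) hij hxy.symm).1
    induction e with | _ a b
    rw [Sym2.mk_isDiag_iff, key a (by simp), key b (by simp)]

theorem card_sierpV_zero : (sierpV 0).card = 3 := by
  have : sierpV 0 = Finset.univ.image cornerPt := by
    ext x
    simp [mem_sierpV_zero, eq_comm]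
  rw [this, Finset.card_image_of_injective _ cornerPt_injective]
  rfl

theorem card_sierpV_succ (n : ℕ) : (sierpV (n + 1)).card + 3 = 3 * (sierpV n).card := by
  have hinter : ∀ i j, i ≠ j →
      (sierpV n).image (psi i) ∩ (sierpV n).image (psi j) = {psi i (cornerPt j)} := by
    intro i j hij
    ext x
    simp only [Finset.mem_inter, Finset.mem_image, Finset.mem_singleton]
    constructor
    · rintro ⟨⟨v, hv, rfl⟩, w, hw, h⟩
      rw [(eq_cornerPt_of_psi_eq hv hw hij h.symm).1]
    · rintro rfl
      exact ⟨⟨_, cornerPt_mem_sierpV n j, rfl⟩, _, cornerPt_mem_sierpV n i, psi_cornerPt_comm j i⟩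
  have hcard : ∀ i, ((sierpV n).image (psi i)).card = (sierpV n).card :=
    fun i => Finset.card_image_of_injective _ (psi_injective i)
  have hne : psi 0 (cornerPt 2) ≠ psi 1 (cornerPt 2) := by
    intro h
    have := (eq_cornerPt_of_psi_eq (cornerPt_mem_sierpV n 2) (cornerPt_mem_sierpV n 2)
      (by simp) h).1
    simpa using cornerPt_injective this
  have hpair : ({psi 0 (cornerPt 2)} ∪ {psi 1 (cornerPt 2)} : Finset Pt).card = 2 := by
    rw [← Finset.insert_eq, Finset.card_pair hne]
  have h1 := Finset.card_union_add_card_inter ((sierpV n).image (psi 0)) ((sierpV n).image (psi 1))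
  have h2 := Finset.card_union_add_card_inter
    ((sierpV n).image (psi 0) ∪ (sierpV n).image (psi 1)) ((sierpV n).image (psi 2))
  rw [Finset.union_inter_distrib_right, hinter 0 2 (by simp), hinter 1 2 (by simp), hpair,
    hcard] at h2
  rw [hinter 0 1 (by simp), Finset.card_singleton, hcard, hcard] at h1
  simp only [sierpV]
  omega

/-- The spanning forests of `G_n` in which every component contains a corner, and whose
partition of the corners is the one labelled by `κ`. -/
def forestClass (n : ℕ) (κ : Fin 5) : Finset (Finset (Sym2 Pt)) :=
  (sierpE n).powerset.filter fun F =>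
    (graphOf F).IsAcyclic ∧
    (∀ i j, (graphOf F).Reachable (cornerPt i) (cornerPt j) ↔ lab κ i = lab κ j) ∧
    ∀ x ∈ sierpV n, ∃ i, (graphOf F).Reachable x (cornerPt i)

theorem mem_forestClass {n : ℕ} {κ : Fin 5} {F : Finset (Sym2 Pt)} :
    F ∈ forestClass n κ ↔ F ⊆ sierpE n ∧ (graphOf F).IsAcyclic ∧
      (∀ i j, (graphOf F).Reachable (cornerPt i) (cornerPt j) ↔ lab κ i = lab κ j) ∧
      ∀ x ∈ sierpV n, ∃ i, (graphOf F).Reachable x (cornerPt i) := by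
  simp [forestClass]

theorem treeSet_eq_forestClass (n : ℕ) : treeSet n = forestClass n 0 := by
  ext F
  rw [mem_forestClass, treeSet, Finset.mem_filter, Finset.mem_powerset]
  refine and_congr_right fun _ => and_congr_right fun _ => ⟨fun h => ⟨fun i j => ?_, fun x hx => ?_⟩,
    fun ⟨h, h'⟩ x hx y hy => ?_⟩
  · simp only [lab, iff_true]
    exact h _ (cornerPt_mem_sierpV n i) _ (cornerPt_mem_sierpV n j)
  · exact ⟨0, h x hx _ (cornerPt_mem_sierpV n 0)⟩
  · obtain ⟨i, hi⟩ := h' x hx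
    obtain ⟨j, hj⟩ := h' y hy
    exact hi.trans (((h i j).2 rfl).trans hj.symm)

theorem isAcyclic_iff_card {n : ℕ} {κ : Fin 5} {F : Finset (Sym2 Pt)} (hF : F ⊆ sierpE n)
    (hκ : ∀ i j, (graphOf F).Reachable (cornerPt i) (cornerPt j) ↔ lab κ i = lab κ j)
    (hr : ∀ x ∈ sierpV n, ∃ i, (graphOf F).Reachable x (cornerPt i)) :
    (graphOf F).IsAcyclic ↔ F.card + blocks κ = (sierpV n).card := by
  rw [(card_le_and_isAcyclic_iff (sierpV n) F (fun e he x hx => mem_sierpV_of_mem_sierpE (hF he) hx)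
    fun e he => not_isDiag_of_mem_sierpE (hF he)).2]
  suffices (comps (sierpV n) F).card = blocks κ by rw [this]
  have h1 : comps (sierpV n) F =
      Finset.univ.image fun i => (graphOf F).connectedComponentMk (cornerPt i) := by
    ext c
    simp only [comps, Finset.mem_image, Finset.mem_univ, true_and]
    constructor
    · rintro ⟨x, hx, rfl⟩
      obtain ⟨i, hi⟩ := hr x hx
      exact ⟨i, SimpleGraph.ConnectedComponent.sound hi.symm⟩
    · rintro ⟨i, rfl⟩
      exact ⟨_, cornerPt_mem_sierpV n i, rfl⟩
  rw [h1, ← card_image_lab κ]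
  have h2 : ∀ i j, (graphOf F).connectedComponentMk (cornerPt i) =
      (graphOf F).connectedComponentMk (cornerPt j) ↔ lab κ i = lab κ j := fun i j =>
    SimpleGraph.ConnectedComponent.eq.trans (hκ i j)
  obtain ⟨g, hg⟩ : ∃ g : ℕ → (graphOf F).ConnectedComponent,
      ∀ i, g (lab κ i) = (graphOf F).connectedComponentMk (cornerPt i) := by
    refine ⟨fun m => if h : ∃ i, lab κ i = m then
      (graphOf F).connectedComponentMk (cornerPt h.choose) else
      (graphOf F).connectedComponentMk (cornerPt 0), fun i => ?_⟩
    have h : ∃ j, lab κ j = lab κ i := ⟨i, rfl⟩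
    simp only [dif_pos h]
    exact (h2 _ _).2 h.choose_spec
  have h3 : (Finset.univ.image fun i => (graphOf F).connectedComponentMk (cornerPt i)) =
      (Finset.univ.image (lab κ)).image g := by
    ext c
    simp [hg]
  rw [h3]
  trans (Finset.univ.image (lab κ)).card
  · refine Finset.card_image_of_injOn ?_
    intro a ha b hb hab
    simp only [Finset.coe_image, Finset.coe_univ, Set.image_univ, Set.mem_range] at ha hb
    obtain ⟨i, rfl⟩ := ha
    obtain ⟨j, rfl⟩ := hb
    rw [hg, hg] at hab
    exact (h2 i j).1 hab
  · congr!

/-- The union of the images of the edge sets `f i` under the maps `ψ_i`. -/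
def glue (f : Fin 3 → Finset (Sym2 Pt)) : Finset (Sym2 Pt) :=
  Finset.univ.biUnion fun i => (f i).image (Sym2.map (psi i))

theorem mem_glue {f : Fin 3 → Finset (Sym2 Pt)} {e : Sym2 Pt} :
    e ∈ glue f ↔ ∃ i, ∃ e' ∈ f i, e'.map (psi i) = e := by
  simp [glue]

theorem map_psi_mem_glue {n : ℕ} {f : Fin 3 → Finset (Sym2 Pt)} (hf : ∀ i, f i ⊆ sierpE n)
    {e : Sym2 Pt} (he : e ∈ sierpE n) {i : Fin 3} : e.map (psi i) ∈ glue f ↔ e ∈ f i := by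
  rw [mem_glue]
  constructor
  · rintro ⟨j, e', he', h⟩
    obtain ⟨rfl, rfl⟩ := eq_of_map_psi_eq (hf j he') he h
    exact he'
  · exact fun h => ⟨i, e, h, rfl⟩

theorem glue_subset {n : ℕ} {f : Fin 3 → Finset (Sym2 Pt)} (hf : ∀ i, f i ⊆ sierpE n) :
    glue f ⊆ sierpE (n + 1) := by
  intro e he
  obtain ⟨i, e', he', rfl⟩ := mem_glue.1 he
  exact mem_sierpE_succ.2 ⟨i, e', hf i he', rfl⟩

theorem glue_injOn {n : ℕ} {f g : Fin 3 → Finset (Sym2 Pt)} (hf : ∀ i, f i ⊆ sierpE n)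
    (hg : ∀ i, g i ⊆ sierpE n) (h : glue f = glue g) : f = g := by
  funext i
  ext e
  constructor
  · intro he
    exact (map_psi_mem_glue hg (hf i he)).1 (h ▸ (map_psi_mem_glue hf (hf i he)).2 he)
  · intro he
    exact (map_psi_mem_glue hf (hg i he)).1 (h ▸ (map_psi_mem_glue hg (hg i he)).2 he)

theorem exists_glue_eq {n : ℕ} {F : Finset (Sym2 Pt)} (hF : F ⊆ sierpE (n + 1)) :
    ∃ f : Fin 3 → Finset (Sym2 Pt), (∀ i, f i ⊆ sierpE n) ∧ glue f = F := by
  refine ⟨fun i => (sierpE n).filter fun e => e.map (psi i) ∈ F,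
    fun i => Finset.filter_subset _ _, ?_⟩
  ext e
  rw [mem_glue]
  constructor
  · rintro ⟨i, e', he', rfl⟩
    exact (Finset.mem_filter.1 he').2
  · intro he
    obtain ⟨i, e', he', rfl⟩ := mem_sierpE_succ.1 (hF he)
    exact ⟨i, e', Finset.mem_filter.2 ⟨he', he⟩, rfl⟩

theorem card_glue {n : ℕ} {f : Fin 3 → Finset (Sym2 Pt)} (hf : ∀ i, f i ⊆ sierpE n) :
    (glue f).card = (f 0).card + (f 1).card + (f 2).card := by
  rw [glue, Finset.card_biUnion, Fin.sum_univ_three]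
  · simp only [Finset.card_image_of_injective _ (Sym2.map.injective (psi_injective _))]
  · intro i _ j _ hij
    rw [Function.onFun, Finset.disjoint_left]
    intro e he he'
    obtain ⟨a, ha, rfl⟩ := Finset.mem_image.1 he
    obtain ⟨b, hb, hab⟩ := Finset.mem_image.1 he'
    exact hij (eq_of_map_psi_eq (hf j hb) (hf i ha) hab).1.symm

/-- The map `ψ_i` from the `i`-th piece to the glued graph. -/
def psiHom (f : Fin 3 → Finset (Sym2 Pt)) (i : Fin 3) : graphOf (f i) →g graphOf (glue f) where
  toFun := psi i
  map_rel' := by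
    intro a b hab
    obtain ⟨h, hne⟩ := graphOf_adj.1 hab
    exact graphOf_adj.2 ⟨mem_glue.2 ⟨i, _, h, rfl⟩, (psi_injective i).ne hne⟩

theorem glue_adj {f : Fin 3 → Finset (Sym2 Pt)} {x y : Pt} (h : (graphOf (glue f)).Adj x y) :
    ∃ i v w, psi i v = x ∧ psi i w = y ∧ (graphOf (f i)).Adj v w := by
  obtain ⟨h, hne⟩ := graphOf_adj.1 h
  obtain ⟨i, e, he, hxy⟩ := mem_glue.1 h
  induction e with | _ a b
  rw [Sym2.map_mk] at hxy
  rcases Sym2.eq_iff.1 hxy with ⟨rfl, rfl⟩ | ⟨rfl, rfl⟩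
  · exact ⟨i, a, b, rfl, rfl, graphOf_adj.2 ⟨he, ne_of_apply_ne _ hne⟩⟩
  · exact ⟨i, b, a, rfl, rfl, graphOf_adj.2 ⟨by rwa [Sym2.eq_swap], ne_of_apply_ne _ hne⟩⟩

theorem mem_sierpV_of_adj {n : ℕ} {F : Finset (Sym2 Pt)} (hF : F ⊆ sierpE n) {x y : Pt}
    (h : (graphOf F).Adj x y) : x ∈ sierpV n ∧ y ∈ sierpV n :=
  ⟨mem_sierpV_of_mem_sierpE (hF (graphOf_adj.1 h).1) (by simp),
    mem_sierpV_of_mem_sierpE (hF (graphOf_adj.1 h).1) (by simp)⟩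

/-- If every vertex of the glued graph is connected to a corner, so is every vertex of a piece. -/
theorem reachable_cornerPt_of_glue {n : ℕ} {f : Fin 3 → Finset (Sym2 Pt)}
    (hf : ∀ i, f i ⊆ sierpE n)
    (hr : ∀ x ∈ sierpV (n + 1), ∃ i, (graphOf (glue f)).Reachable x (cornerPt i))
    (i : Fin 3) {v : Pt} (hv : v ∈ sierpV n) : ∃ j, (graphOf (f i)).Reachable v (cornerPt j) := by
  by_contra! hcon
  obtain ⟨c, hc⟩ := hr (psi i v) (mem_sierpV_succ.2 ⟨i, v, hv, rfl⟩)
  have hstep : ∀ x y, (∃ w ∈ sierpV n, psi i w = x ∧ (graphOf (f i)).Reachable v w) →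
      (graphOf (glue f)).Adj x y →
      ∃ w ∈ sierpV n, psi i w = y ∧ (graphOf (f i)).Reachable v w := by
    rintro _ y ⟨w, hw, rfl, hvw⟩ hadj
    obtain ⟨j, a, b, hab, rfl, h⟩ := glue_adj hadj
    obtain ⟨ha, hb⟩ := mem_sierpV_of_adj (hf j) h
    by_cases hij : j = i
    · subst hij
      obtain rfl := psi_injective j hab
      exact ⟨b, hb, rfl, hvw.trans h.reachable⟩
    · rw [(eq_cornerPt_of_psi_eq hw ha (Ne.symm hij) hab.symm).1] at hvw
      exact absurd hvw (hcon j)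
  obtain ⟨w, hw, hwc, hvw⟩ := reachable_invariant hstep hc ⟨v, hv, rfl, .rfl⟩
  rw [eq_cornerPt_of_psi_eq_cornerPt hw hwc] at hvw
  exact hcon c hvw

theorem reachable_glue_iff {n : ℕ} {f : Fin 3 → Finset (Sym2 Pt)} {k : Fin 3 → Fin 5}
    (hf : ∀ i, f i ⊆ sierpE n)
    (hk : ∀ i a b, (graphOf (f i)).Reachable (cornerPt a) (cornerPt b) ↔
      lab (k i) a = lab (k i) b)
    (p q : Fin 3 × Fin 3) :
    (graphOf (glue f)).Reachable (psi p.1 (cornerPt p.2)) (psi q.1 (cornerPt q.2)) ↔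
      glueLabel k p = glueLabel k q := by
  have hcorner : ∀ p : Fin 3 × Fin 3, ∀ i, ∀ v ∈ sierpV n, ∀ a,
      psi i v = psi p.1 (cornerPt p.2) → (graphOf (f i)).Reachable v (cornerPt a) →
      glueLabel k (i, a) = glueLabel k p := by
    rintro ⟨j, b⟩ i v hv a hva hreach
    by_cases hij : i = j
    · subst hij
      rw [psi_injective i hva] at hreach
      exact (glueLabel_of_lab_eq ((hk _ _ _).1 hreach)).symm
    · obtain ⟨rfl, h2⟩ := eq_cornerPt_of_psi_eq hv (cornerPt_mem_sierpV n b) hij hva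
      obtain rfl := cornerPt_injective h2
      rw [← glueLabel_of_lab_eq ((hk _ _ _).1 hreach), glueLabel_swap]
  constructor
  · intro h
    have hstep : ∀ x y, (∃ i, ∃ v ∈ sierpV n, ∃ a, psi i v = x ∧
        (graphOf (f i)).Reachable v (cornerPt a) ∧ glueLabel k (i, a) = glueLabel k p) →
        (graphOf (glue f)).Adj x y → ∃ i, ∃ v ∈ sierpV n, ∃ a, psi i v = y ∧
        (graphOf (f i)).Reachable v (cornerPt a) ∧ glueLabel k (i, a) = glueLabel k p := by
      rintro _ y ⟨i, v, hv, a, rfl, hreach, hlab⟩ hadj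
      obtain ⟨j, v', w, hvv, rfl, h⟩ := glue_adj hadj
      obtain ⟨hv', hw⟩ := mem_sierpV_of_adj (hf j) h
      by_cases hij : j = i
      · subst hij
        obtain rfl := psi_injective j hvv
        exact ⟨j, w, hw, a, rfl, h.symm.reachable.trans hreach, hlab⟩
      · obtain ⟨h1, h2⟩ := eq_cornerPt_of_psi_eq hv hv' (Ne.symm hij) hvv.symm
        subst h1 h2
        refine ⟨j, w, hw, i, rfl, h.symm.reachable, ?_⟩
        rw [glueLabel_swap, ← hlab]
        exact glueLabel_of_lab_eq ((hk _ _ _).1 hreach)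
    obtain ⟨i, v, hv, a, hva, hreach, hlab⟩ := reachable_invariant hstep h
      ⟨p.1, _, cornerPt_mem_sierpV n p.2, p.2, rfl, .rfl, rfl⟩
    exact hlab.symm.trans (hcorner q i v hv a hva hreach)
  · intro h
    refine reachable_of_glueLabel_eq (f := fun p => psi p.1 (cornerPt p.2)) ?_ ?_ h
    · intro i a b hab
      exact ((hk i a b).2 hab).map (psiHom f i)
    · intro i j
      simp only [psi_cornerPt_comm i j]
      exact .rfl

theorem glue_mem_forestClass_iff {n : ℕ} {f : Fin 3 → Finset (Sym2 Pt)} {κ : Fin 5} :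
    (∀ i, f i ⊆ sierpE n) → (glue f ∈ forestClass (n + 1) κ ↔
      ∃ k : Fin 3 → Fin 5, k ∈ goodTriples κ ∧ ∀ i, f i ∈ forestClass n (k i)) := by
  intro hf
  have main : ∀ k : Fin 3 → Fin 5,
      (∀ i a b, (graphOf (f i)).Reachable (cornerPt a) (cornerPt b) ↔
        lab (k i) a = lab (k i) b) →
      (∀ i, ∀ x ∈ sierpV n, ∃ j, (graphOf (f i)).Reachable x (cornerPt j)) →
      (∀ i, (graphOf (f i)).IsAcyclic) →
      (glue f ∈ forestClass (n + 1) κ ↔ k ∈ goodTriples κ) := by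
    intro k hk hr hac
    have hreach := reachable_glue_iff hf hk
    have hcorner : ∀ i j, (graphOf (glue f)).Reachable (cornerPt i) (cornerPt j) ↔
        glueLabel k (i, i) = glueLabel k (j, j) := by
      intro i j
      rw [← hreach (i, i) (j, j), psi_cornerPt_self, psi_cornerPt_self]
    have hrooted : (∀ x ∈ sierpV (n + 1), ∃ i, (graphOf (glue f)).Reachable x (cornerPt i)) ↔
        ∀ i a, ∃ j, glueLabel k (i, a) = glueLabel k (j, j) := by
      constructor
      · intro h i a
        obtain ⟨j, hj⟩ := h (psi i (cornerPt a))
          (mem_sierpV_succ.2 ⟨i, _, cornerPt_mem_sierpV n a, rfl⟩)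
        rw [← psi_cornerPt_self j] at hj
        exact ⟨j, (hreach (i, a) (j, j)).1 hj⟩
      · intro h x hx
        obtain ⟨i, v, hv, rfl⟩ := mem_sierpV_succ.1 hx
        obtain ⟨a, ha⟩ := hr i v hv
        obtain ⟨j, hj⟩ := h i a
        have hj' := (hreach (i, a) (j, j)).2 hj
        rw [psi_cornerPt_self] at hj'
        exact ⟨j, (ha.map (psiHom f i)).trans hj'⟩
    have hgood : k ∈ goodTriples κ ↔
        blocks (k 0) + blocks (k 1) + blocks (k 2) = 3 + blocks κ ∧
        (∀ i j, glueLabel k (i, i) = glueLabel k (j, j) ↔ lab κ i = lab κ j) ∧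
        ∀ i a, ∃ j, glueLabel k (i, a) = glueLabel k (j, j) := by
      rw [mem_goodTriples]
    rw [mem_forestClass, hgood, hrooted]
    simp only [hcorner]
    have hcard := fun i => (isAcyclic_iff_card (hf i) (hk i) (hr i)).1 (hac i)
    have hV := card_sierpV_succ n
    have hg := card_glue hf
    have := hcard 0
    have := hcard 1
    have := hcard 2
    constructor
    · rintro ⟨hsub, hacg, h1, h2⟩
      have := (isAcyclic_iff_card hsub (fun i j => (hcorner i j).trans (h1 i j))
        (hrooted.2 h2)).1 hacg
      exact ⟨by omega, h1, h2⟩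
    · rintro ⟨hb, h1, h2⟩
      refine ⟨glue_subset hf, (isAcyclic_iff_card (glue_subset hf)
        (fun i j => (hcorner i j).trans (h1 i j)) (hrooted.2 h2)).2 (by omega), h1, h2⟩
  constructor
  · intro hglue
    have hr := fun i v (hv : v ∈ sierpV n) =>
      reachable_cornerPt_of_glue hf (mem_forestClass.1 hglue).2.2.2 i hv
    have hac : ∀ i, (graphOf (f i)).IsAcyclic := fun i =>
      (mem_forestClass.1 hglue).2.1.comap (psiHom f i) (psi_injective i)
    choose k hk using fun i => exists_lab
      (r := fun a b => (graphOf (f i)).Reachable (cornerPt a) (cornerPt b))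
      ⟨fun _ => .rfl, fun h => h.symm, fun h h' => h.trans h'⟩
    exact ⟨k, (main k hk hr hac).1 hglue, fun i =>
      mem_forestClass.2 ⟨hf i, hac i, hk i, hr i⟩⟩
  · rintro ⟨k, hgood, hmem⟩
    have h := fun i => mem_forestClass.1 (hmem i)
    exact (main k (fun i => (h i).2.2.1) (fun i => (h i).2.2.2) (fun i => (h i).2.1)).2 hgood

theorem forestClass_disjoint {n : ℕ} {κ κ' : Fin 5} {F : Finset (Sym2 Pt)}
    (h : F ∈ forestClass n κ) (h' : F ∈ forestClass n κ') : κ = κ' :=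
  lab_injective fun i j =>
    ((mem_forestClass.1 h).2.2.1 i j).symm.trans ((mem_forestClass.1 h').2.2.1 i j)

/-- A sum over the forests of `G_{n+1}` of a multiplicative weight is a polynomial in the
sums over the forests of `G_n`. -/
theorem sum_forestClass_succ {R : Type*} [CommRing R] {n : ℕ} {κ : Fin 5}
    {g g' : Finset (Sym2 Pt) → R}
    (hg : ∀ f : Fin 3 → Finset (Sym2 Pt), (∀ i, f i ⊆ sierpE n) → g' (glue f) = ∏ i, g (f i)) :
    ∑ F ∈ forestClass (n + 1) κ, g' F =
      ∑ k ∈ goodTriples κ, ∏ i, ∑ F ∈ forestClass n (k i), g F := by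
  simp only [Finset.prod_univ_sum]
  rw [Finset.sum_sigma']
  symm
  have hsub : ∀ k : Fin 3 → Fin 5, ∀ f ∈ Fintype.piFinset fun i => forestClass n (k i),
      ∀ i, f i ⊆ sierpE n := fun k f hf i =>
    (mem_forestClass.1 (Fintype.mem_piFinset.1 hf i)).1
  refine Finset.sum_bij (fun p _ => glue p.2) ?_ ?_ ?_ ?_
  · rintro ⟨k, f⟩ h
    obtain ⟨hk, hf⟩ := Finset.mem_sigma.1 h
    exact (glue_mem_forestClass_iff (hsub k f hf)).2
      ⟨k, hk, Fintype.mem_piFinset.1 hf⟩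
  · rintro ⟨k, f⟩ h ⟨k', f'⟩ h' heq
    have hf := (Finset.mem_sigma.1 h).2
    have hf' := (Finset.mem_sigma.1 h').2
    obtain rfl := glue_injOn (hsub k f hf) (hsub k' f' hf') heq
    obtain rfl : k = k' := funext fun i =>
      forestClass_disjoint (Fintype.mem_piFinset.1 hf i) (Fintype.mem_piFinset.1 hf' i)
    rfl
  · intro F hF
    obtain ⟨f, hf, rfl⟩ := exists_glue_eq (mem_forestClass.1 hF).1
    obtain ⟨k, hk, hmem⟩ := (glue_mem_forestClass_iff hf).1 hF
    exact ⟨⟨k, f⟩, Finset.mem_sigma.2 ⟨hk,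
      Fintype.mem_piFinset.2 hmem⟩, rfl⟩
  · rintro ⟨k, f⟩ h
    exact (hg f (hsub k f (Finset.mem_sigma.1 h).2)).symm

/-- The edge of `G_0` opposite to the corner `k`. -/
def cornerEdge (k : Fin 3) : Sym2 Pt := s(cornerPt (k + 1), cornerPt (k + 2))

theorem cornerEdge_injective : Function.Injective cornerEdge := by
  intro i j h
  by_contra hij
  rcases Sym2.eq_iff.1 h with ⟨h1, h2⟩ | ⟨h1, h2⟩
  · exact hij (add_right_cancel (cornerPt_injective h1))
  · have h3 := cornerPt_injective h1
    have h4 := cornerPt_injective h2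
    omega

theorem sierpE_zero : sierpE 0 = Finset.univ.image cornerEdge := by
  ext e
  simp only [sierpE, Finset.mem_insert, Finset.mem_singleton, Finset.mem_image, Finset.mem_univ,
    true_and, Fin.exists_fin_succ, cornerEdge, @eq_comm _ _ e]
  simp
  tauto

theorem cornerEdge_eq {i j : Fin 3} (h : i ≠ j) :
    cornerEdge (-(i + j)) = s(cornerPt i, cornerPt j) := by
  rcases opposite_edge h with ⟨h1, h2⟩ | ⟨h1, h2⟩
  · rw [cornerEdge, h1, h2]
  · rw [cornerEdge, h1, h2, Sym2.eq_swap]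

theorem reachable_image_cornerEdge (A : Finset (Fin 3)) (i j : Fin 3) :
    (graphOf (A.image cornerEdge)).Reachable (cornerPt i) (cornerPt j) ↔ triangleConn A i j := by
  have hedge : ∀ i j, i ≠ j → -(i + j) ∈ A →
      (graphOf (A.image cornerEdge)).Reachable (cornerPt i) (cornerPt j) := by
    intro i j hij h
    refine SimpleGraph.Adj.reachable (graphOf_adj.2 ⟨?_, cornerPt_injective.ne hij⟩)
    rw [← cornerEdge_eq hij]
    exact Finset.mem_image_of_mem _ h
  constructor
  · intro h
    have hstep : ∀ x y, (∃ j, cornerPt j = x ∧ triangleConn A i j) →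
        (graphOf (A.image cornerEdge)).Adj x y → ∃ j, cornerPt j = y ∧ triangleConn A i j := by
      rintro _ y ⟨j, rfl, hj⟩ hadj
      obtain ⟨k, hk, he⟩ := Finset.mem_image.1 (graphOf_adj.1 hadj).1
      rcases Sym2.eq_iff.1 he with ⟨h1, rfl⟩ | ⟨rfl, h1⟩
      · obtain rfl := cornerPt_injective h1
        exact ⟨_, rfl, (triangleConn_step hk).1 hj⟩
      · obtain rfl := cornerPt_injective h1
        exact ⟨_, rfl, (triangleConn_step hk).2 hj⟩
    obtain ⟨j', hj', hc⟩ := reachable_invariant hstep h ⟨i, rfl, Or.inl rfl⟩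
    exact cornerPt_injective hj' ▸ hc
  · intro h
    by_cases hij : i = j
    · exact hij ▸ .rfl
    rcases h with rfl | h | ⟨hi, hj⟩
    · exact .rfl
    · exact hedge i j hij h
    · have e1 : -(i + -(i + j)) = j := by abel
      have e2 : -(-(i + j) + j) = i := by abel
      have h1 : -(i + -(i + j)) ∈ A := e1.symm.subst (motive := (· ∈ A)) hj
      have h2 : -(-(i + j) + j) ∈ A := e2.symm.subst (motive := (· ∈ A)) hi
      by_cases hik : i = -(i + j)
      · exact hedge i j hij (hik.subst (motive := (· ∈ A)) hi)
      by_cases hjk : -(i + j) = j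
      · exact hedge i j hij (hjk.symm.subst (motive := (· ∈ A)) hj)
      exact (hedge i _ hik h1).trans (hedge _ j hjk h2)

theorem card_of_mem_forestClass_zero {κ : Fin 5} {F : Finset (Sym2 Pt)}
    (hF : F ∈ forestClass 0 κ) : F.card + blocks κ = 3 := by
  obtain ⟨hsub, hac, hκ, hr⟩ := mem_forestClass.1 hF
  rw [(isAcyclic_iff_card hsub hκ hr).1 hac, card_sierpV_zero]

theorem card_forestClass_zero (κ : Fin 5) :
    (forestClass 0 κ).card = if κ = 0 then 3 else 1 := by
  rw [← card_triangleForests κ]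
  symm
  have hroot : ∀ F : Finset (Sym2 Pt), ∀ x ∈ sierpV 0,
      ∃ i, (graphOf F).Reachable x (cornerPt i) := by
    intro F x hx
    obtain ⟨i, rfl⟩ := mem_sierpV_zero.1 hx
    exact ⟨i, .rfl⟩
  refine Finset.card_bij (fun A _ => A.image cornerEdge) ?_ ?_ ?_
  · intro A hA
    obtain ⟨hcard, hA⟩ := mem_triangleForests.1 hA
    have hκ := fun i j => (reachable_image_cornerEdge A i j).trans (hA i j)
    have hsub : A.image cornerEdge ⊆ sierpE 0 := by
      rw [sierpE_zero]
      exact Finset.image_subset_image (Finset.subset_univ _)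
    refine mem_forestClass.2 ⟨hsub, (isAcyclic_iff_card hsub hκ (hroot _)).2 ?_, hκ, hroot _⟩
    rw [Finset.card_image_of_injective _ cornerEdge_injective, hcard, card_sierpV_zero]
  · intro A _ B _ h
    exact Finset.image_injective cornerEdge_injective h
  · intro F hF
    have hcard := card_of_mem_forestClass_zero hF
    obtain ⟨hsub, -, hκ, -⟩ := mem_forestClass.1 hF
    rw [sierpE_zero] at hsub
    obtain ⟨A, -, rfl⟩ := Finset.subset_image_iff.1 hsub
    rw [Finset.card_image_of_injective _ cornerEdge_injective] at hcard
    exact ⟨A, mem_triangleForests.2 ⟨hcard, fun i j =>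
      (reachable_image_cornerEdge A i j).symm.trans (hκ i j)⟩, rfl⟩

theorem psiWord_zero (w : Fin 0 → Fin 3) : psiWord w = id := by
  simp [psiWord]

theorem psiWord_cons {n : ℕ} (j : Fin 3) (w : Fin n → Fin 3) :
    psiWord (Fin.cons j w : Fin (n + 1) → Fin 3) = psi j ∘ psiWord w := by
  simp [psiWord]

theorem image_psiWord_subset {n : ℕ} (w : Fin n → Fin 3) :
    (sierpE 0).image (Sym2.map (psiWord w)) ⊆ sierpE n := by
  induction n with
  | zero => simp [psiWord_zero]
  | succ n ih =>
    rw [← Fin.cons_self_tail w, psiWord_cons, Sym2.map_comp, ← Finset.image_image]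
    intro e he
    obtain ⟨e', he', rfl⟩ := Finset.mem_image.1 he
    exact mem_sierpE_succ.2 ⟨w 0, e', ih _ he', rfl⟩

theorem card_filter_cell_glue {n : ℕ} {f : Fin 3 → Finset (Sym2 Pt)}
    (hf : ∀ i, f i ⊆ sierpE n) (j : Fin 3) (w : Fin n → Fin 3) :
    ((glue f).filter fun e => e ∈ (sierpE 0).image
      (Sym2.map (psiWord (Fin.cons j w : Fin (n + 1) → Fin 3)))).card =
    ((f j).filter fun e => e ∈ (sierpE 0).image (Sym2.map (psiWord w))).card := by
  rw [psiWord_cons, Sym2.map_comp, ← Finset.image_image]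
  have h : ((glue f).filter fun e => e ∈ ((sierpE 0).image (Sym2.map (psiWord w))).image
      (Sym2.map (psi j))) =
      ((f j).filter fun e => e ∈ (sierpE 0).image (Sym2.map (psiWord w))).image
        (Sym2.map (psi j)) := by
    ext e
    rw [Finset.mem_filter, Finset.mem_image, Finset.mem_image]
    constructor
    · rintro ⟨he, e', he', rfl⟩
      exact ⟨e', Finset.mem_filter.2
        ⟨(map_psi_mem_glue hf (image_psiWord_subset w he')).1 he, he'⟩, rfl⟩
    · rintro ⟨e', he', rfl⟩
      obtain ⟨h1, h2⟩ := Finset.mem_filter.1 he'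
      exact ⟨mem_glue.2 ⟨j, e', h1, rfl⟩, e', h2, rfl⟩
  rw [h, Finset.card_image_of_injective _ (Sym2.map.injective (psi_injective j))]

theorem cellTypeCount_glue {n : ℕ} {f : Fin 3 → Finset (Sym2 Pt)}
    (hf : ∀ i, f i ⊆ sierpE n) (i : ℕ) :
    cellTypeCount (n + 1) i (glue f) = ∑ j, cellTypeCount n i (f j) := by
  simp only [cellTypeCount, Finset.card_filter _ Finset.univ]
  rw [← (Fin.consEquiv fun _ => Fin 3).sum_comp, Fintype.sum_prod_type]
  refine Finset.sum_congr rfl fun j _ => Finset.sum_congr rfl fun w _ => ?_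
  simp only [← card_filter_cell_glue hf j w]
  rfl

theorem cellTypeCount_zero (i : ℕ) {F : Finset (Sym2 Pt)} (hF : F ⊆ sierpE 0) :
    cellTypeCount 0 i F = if F.card = i then 1 else 0 := by
  have h : F.filter (fun e => e ∈ sierpE 0) = F := Finset.filter_true_of_mem fun e he => hF he
  simp only [cellTypeCount, psiWord_zero, Sym2.map_id, Finset.image_id, h, Finset.card_filter]
  simp

open scoped DualNumber

/-- The weight `1 + N_i(F) ε`, which turns the number of cells into a multiplicative quantity. -/
def weight (n i : ℕ) (F : Finset (Sym2 Pt)) : ℝ[ε] :=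
  TrivSqZeroExt.inl 1 + TrivSqZeroExt.inr (cellTypeCount n i F : ℝ)

theorem weight_glue {n : ℕ} (i : ℕ) {f : Fin 3 → Finset (Sym2 Pt)} (hf : ∀ i, f i ⊆ sierpE n) :
    weight (n + 1) i (glue f) = ∏ j, weight n i (f j) := by
  rw [weight, cellTypeCount_glue hf, Fin.sum_univ_three, Fin.prod_univ_three]
  apply TrivSqZeroExt.ext
  · simp [weight]
  · simp [weight]
    ring

theorem fst_sum_weight (n i : ℕ) (S : Finset (Finset (Sym2 Pt))) :
    (∑ F ∈ S, weight n i F).fst = S.card := by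
  rw [TrivSqZeroExt.fst_sum]
  simp [weight]

theorem snd_sum_weight (n i : ℕ) (S : Finset (Finset (Sym2 Pt))) :
    (∑ F ∈ S, weight n i F).snd = ∑ F ∈ S, (cellTypeCount n i F : ℝ) := by
  rw [TrivSqZeroExt.snd_sum]
  simp [weight]

theorem sum_weight_zero (i : ℕ) (κ : Fin 5) :
    ∑ F ∈ forestClass 0 κ, weight 0 i F =
      TrivSqZeroExt.inl (if κ = 0 then 3 else 1) +
        TrivSqZeroExt.inr ((if κ = 0 then 3 else 1) * (if blocks κ + i = 3 then 1 else 0)) := by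
  apply TrivSqZeroExt.ext
  · rw [fst_sum_weight, card_forestClass_zero]
    simp only [TrivSqZeroExt.fst_add, TrivSqZeroExt.fst_inl, TrivSqZeroExt.fst_inr]
    split_ifs <;> simp
  · rw [snd_sum_weight]
    have h : ∀ F ∈ forestClass 0 κ,
        (cellTypeCount 0 i F : ℝ) = if blocks κ + i = 3 then 1 else 0 := by
      intro F hF
      have := card_of_mem_forestClass_zero hF
      rw [cellTypeCount_zero i (mem_forestClass.1 hF).1]
      have : F.card = i ↔ blocks κ + i = 3 := by omega
      simp [this]
    rw [Finset.sum_congr rfl h, Finset.sum_const, card_forestClass_zero]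
    simp only [TrivSqZeroExt.snd_add, TrivSqZeroExt.snd_inl, TrivSqZeroExt.snd_inr]
    split_ifs <;> simp

theorem sum_weight_succ {n i : ℕ} {t s r : ℝ[ε]}
    (h : ∀ κ, ∑ F ∈ forestClass n κ, weight n i F = if κ = 0 then t else if κ = 4 then r else s)
    (κ : Fin 5) :
    ∑ F ∈ forestClass (n + 1) κ, weight (n + 1) i F =
      if κ = 0 then 6 * (t ^ 2 * s) else if κ = 4 then 14 * s ^ 3 + 12 * (t * s * r)
      else 7 * (t * s ^ 2) + t ^ 2 * r := by
  rw [sum_forestClass_succ fun f hf => weight_glue i hf]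
  simp only [h]
  have h1 : ∀ k, ∏ i, (if k i = 0 then t else if k i = 4 then r else s) =
      t ^ (pattern k).1 * r ^ (pattern k).2 * s ^ (3 - (pattern k).1 - (pattern k).2) := by
    intro k
    simp only [← prod_eq_of_pattern]
  have h2 : ∀ g : ℕ × ℕ → ℝ[ε],
      ∑ k ∈ goodTriples κ, g (pattern k) = (((goodTriples κ).val.map pattern).map g).sum := by
    intro g
    rw [Multiset.map_map]
    rfl
  simp only [h1]
  rw [h2 fun p => t ^ p.1 * r ^ p.2 * s ^ (3 - p.1 - p.2), map_pattern_goodTriples]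
  fin_cases κ <;> simp <;> ring

/-- The average numbers of cells over the forests with one, two and three components satisfy a
linear recursion, with eigenvalues `3`, `1` and `3 / 25`. -/
theorem exists_sum_weight_eq (i : ℕ) {x y z : ℕ → ℝ}
    (hx0 : x 0 = if i = 2 then 1 else 0) (hy0 : y 0 = if i = 1 then 1 else 0)
    (hz0 : z 0 = if i = 0 then 1 else 0)
    (hx : ∀ n, x (n + 1) = 2 * x n + y n)
    (hy : ∀ n, y (n + 1) = 13 / 10 * x n + 7 / 5 * y n + 3 / 10 * z n)
    (hz : ∀ n, z (n + 1) = 18 / 25 * x n + 39 / 25 * y n + 18 / 25 * z n) (n : ℕ) :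
    ∃ t s r : ℝ, 0 < t ∧ 0 < s ∧ t * r = 3 * s ^ 2 ∧
      ∀ κ, ∑ F ∈ forestClass n κ, weight n i F =
        if κ = 0 then TrivSqZeroExt.inl t + TrivSqZeroExt.inr (t * x n)
        else if κ = 4 then TrivSqZeroExt.inl r + TrivSqZeroExt.inr (r * z n)
        else TrivSqZeroExt.inl s + TrivSqZeroExt.inr (s * y n) := by
  induction n with
  | zero =>
    refine ⟨3, 1, 1, by norm_num, by norm_num, by norm_num, fun κ => ?_⟩
    have h1 : 1 + i = 3 ↔ i = 2 := by omega
    have h2 : 2 + i = 3 ↔ i = 1 := by omega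
    rw [sum_weight_zero, hx0, hy0, hz0]
    fin_cases κ <;> simp [blocks, h1, h2]
  | succ n ih =>
    obtain ⟨t, s, r, ht, hs, htr, h⟩ := ih
    refine ⟨6 * (t ^ 2 * s), 10 * (t * s ^ 2), 50 * s ^ 3, by positivity, by positivity, ?_, ?_⟩
    · ring
    · intro κ
      have hfst : ∀ m : ℕ, [m.AtLeastTwo] →
          (OfNat.ofNat m : ℝ[ε]).fst = OfNat.ofNat m := fun m _ => TrivSqZeroExt.fst_natCast m
      have hsnd : ∀ m : ℕ, [m.AtLeastTwo] →
          (OfNat.ofNat m : ℝ[ε]).snd = 0 := fun m _ => TrivSqZeroExt.snd_natCast m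
      rw [sum_weight_succ h, hx, hy, hz]
      split_ifs
      · apply TrivSqZeroExt.ext
        · simp [hfst]
        · simp [pow_succ, hfst, hsnd]
          ring
      · apply TrivSqZeroExt.ext <;> simp [pow_succ, hfst, hsnd]
        · linear_combination 12 * s * htr
        · linear_combination 12 * s * (x n + y n + z n) * htr
      · apply TrivSqZeroExt.ext <;> simp [pow_succ, hfst, hsnd]
        · linear_combination t * htr
        · linear_combination t * (2 * x n + z n) * htr

theorem tendsto_cellTypeCount (i : ℕ) :
    Tendsto (fun n : ℕ =>
        ((∑ t ∈ treeSet n, (cellTypeCount n i t : ℝ)) / ((treeSet n).card : ℝ)) / 3 ^ n)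
      atTop (nhds ((53 * (if i = 2 then 1 else 0) + 38 * (if i = 1 then 1 else 0) +
        5 * (if i = 0 then 1 else 0)) / 96)) := by
  obtain ⟨p, hp⟩ : ∃ p : ℝ, p = if i = 2 then 1 else 0 := ⟨_, rfl⟩
  obtain ⟨q, hq⟩ : ∃ q : ℝ, q = if i = 1 then 1 else 0 := ⟨_, rfl⟩
  obtain ⟨r, hr⟩ : ∃ r : ℝ, r = if i = 0 then 1 else 0 := ⟨_, rfl⟩
  rw [← hp, ← hq, ← hr]
  set L : ℝ := (53 * p + 38 * q + 5 * r) / 96 with hL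
  set b : ℝ := 125 * (p - 2 * q + r) / 1056 with hb
  set a : ℝ := (p - q) / 2 - 36 / 25 * b with ha
  have key := exists_sum_weight_eq i
    (x := fun n => L * 3 ^ n + a + b * (3 / 25) ^ n)
    (y := fun n => L * 3 ^ n - a - 47 / 25 * b * (3 / 25) ^ n)
    (z := fun n => L * 3 ^ n - 3 * a + 461 / 125 * b * (3 / 25) ^ n)
    (by rw [← hp, ha, hb, hL]; ring) (by rw [← hq, ha, hb, hL]; ring)
    (by rw [← hr, ha, hb, hL]; ring) (fun n => by ring) (fun n => by ring) (fun n => by ring)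
  have heq : ∀ n : ℕ,
      ((∑ t ∈ treeSet n, (cellTypeCount n i t : ℝ)) / ((treeSet n).card : ℝ)) / 3 ^ n =
        L + a * (1 / 3) ^ n + b * (1 / 25) ^ n := by
    intro n
    obtain ⟨t, s, r', ht, -, -, h⟩ := key n
    have h0 := h 0
    have h1 := congrArg TrivSqZeroExt.fst h0
    have h2 := congrArg TrivSqZeroExt.snd h0
    rw [fst_sum_weight] at h1
    rw [snd_sum_weight] at h2
    rw [treeSet_eq_forestClass, h1, h2]
    simp only [if_true, TrivSqZeroExt.fst_add, TrivSqZeroExt.snd_add, TrivSqZeroExt.fst_inl,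
      TrivSqZeroExt.snd_inl, TrivSqZeroExt.fst_inr, TrivSqZeroExt.snd_inr, add_zero, zero_add]
    have h3 : (3 / 25 : ℝ) ^ n = 3 ^ n * (1 / 25) ^ n := by rw [← mul_pow]; norm_num
    have h4 : (3 : ℝ) ^ n * (1 / 3) ^ n = 1 := by rw [← mul_pow]; norm_num
    rw [mul_div_cancel_left₀ _ ht.ne', h3, div_eq_iff (by positivity)]
    linear_combination -a * h4
  simp only [heq]
  have h3 : Tendsto (fun n : ℕ => (1 / 3 : ℝ) ^ n) atTop (nhds 0) :=
    tendsto_pow_atTop_nhds_zero_of_lt_one (by norm_num) (by norm_num)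
  have h25 : Tendsto (fun n : ℕ => (1 / 25 : ℝ) ^ n) atTop (nhds 0) :=
    tendsto_pow_atTop_nhds_zero_of_lt_one (by norm_num) (by norm_num)
  simpa using (tendsto_const_nhds.add (h3.const_mul a)).add (h25.const_mul b)

/-- limits of the renormalised expected number of cells containing exactly
`2`, `1`, `0` edges of a uniformly random spanning tree of `G_n`. -/
theorem cell_type_limits :
    Tendsto (fun n : ℕ =>
        ((∑ t ∈ treeSet n, (cellTypeCount n 2 t : ℝ)) / ((treeSet n).card : ℝ)) / 3 ^ n)
      atTop (nhds (53 / 96)) ∧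
    Tendsto (fun n : ℕ =>
        ((∑ t ∈ treeSet n, (cellTypeCount n 1 t : ℝ)) / ((treeSet n).card : ℝ)) / 3 ^ n)
      atTop (nhds (19 / 48)) ∧
    Tendsto (fun n : ℕ =>
        ((∑ t ∈ treeSet n, (cellTypeCount n 0 t : ℝ)) / ((treeSet n).card : ℝ)) / 3 ^ n)
      atTop (nhds (5 / 96)) := by
  refine ⟨?_, ?_, ?_⟩
  · convert tendsto_cellTypeCount 2 using 2
    norm_num
  · convert tendsto_cellTypeCount 1 using 2
    norm_num
  · convert tendsto_cellTypeCount 0 using 2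
    norm_num

end
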